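/- Let n ≥ 2 be an integer and define g : (0,∞) → ℝ by g(r) = sinh(r)^{−(n−1)}·∫₀^r sinh(t)^{n−1} dt. Then the derivative g′ is nonincreasing (antitone) on (0,∞); in particular (g′)² is a decreasing function on (0,∞). -/

import Mathlib

open Real Set

/-- The fundamental theorem of calculus for the integral of a power of `sinh`. -/
theorem hasDerivAt_integral_sinh_pow (m : ℕ) (x : ℝ) :
    HasDerivAt (fun r : ℝ => ∫ t in (0 : ℝ)..r, sinh t ^ m) (sinh x ^ m) x := by
  have hc : Continuous fun t : ℝ => sinh t ^ m := continuous_sinh.pow m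
  exact intervalIntegral.integral_hasDerivAt_right (hc.intervalIntegrable _ _)
    hc.stronglyMeasurable.stronglyMeasurableAtFilter hc.continuousAt

theorem hasDerivAt_sinh_pow_succ (m : ℕ) (x : ℝ) :
    HasDerivAt (fun r : ℝ => sinh r ^ (m + 1)) ((m + 1) * sinh x ^ m * cosh x) x := by
  simpa using (hasDerivAt_sinh x).fun_pow (m + 1)

theorem integral_sinh_pow_le (m : ℕ) {x : ℝ} (hx : 0 ≤ x) :
    ∫ t in (0 : ℝ)..x, sinh t ^ m ≤ cosh x * sinh x ^ (m + 1) / (m * cosh x ^ 2 + 1) := by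
  have hpos (r : ℝ) : 0 < m * cosh r ^ 2 + 1 := by positivity
  have hd (r : ℝ) : HasDerivAt
      (fun r => cosh r * sinh r ^ (m + 1) / (m * cosh r ^ 2 + 1) - ∫ t in (0 : ℝ)..r, sinh t ^ m)
      (2 * sinh r ^ (m + 2) / (m * cosh r ^ 2 + 1) ^ 2) r := by
    have hnum := (hasDerivAt_cosh r).fun_mul (hasDerivAt_sinh_pow_succ m r)
    have hden := (((hasDerivAt_cosh r).fun_pow 2).const_mul (m : ℝ)).add_const 1
    refine ((hnum.fun_div hden (hpos r).ne').fun_sub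
      (hasDerivAt_integral_sinh_pow m r)).congr_deriv ?_
    have h := (hpos r).ne'
    have hC : cosh r ^ 2 = sinh r ^ 2 + 1 := cosh_sq r
    rw [div_sub' (pow_ne_zero 2 h)]
    congr 1
    push_cast
    have h4 : cosh r ^ 4 = (sinh r ^ 2 + 1) ^ 2 := by rw [← hC]; ring
    ring_nf
    simp only [hC, h4]
    ring
  have hmono : MonotoneOn
      (fun r => cosh r * sinh r ^ (m + 1) / (m * cosh r ^ 2 + 1) - ∫ t in (0 : ℝ)..r, sinh t ^ m)
      (Ici 0) := by
    refine monotoneOn_of_hasDerivWithinAt_nonneg (convex_Ici 0)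
      (fun r _ => (hd r).continuousAt.continuousWithinAt)
      (fun r _ => (hd r).hasDerivWithinAt) fun r hr => ?_
    have : 0 ≤ sinh r := sinh_nonneg_iff.2 (interior_subset hr)
    positivity
  have h := hmono self_mem_Ici hx hx
  simp only [sinh_zero, intervalIntegral.integral_same] at h
  simpa using h

theorem monotoneOn_cosh_mul_integral_sinh_pow_div (m : ℕ) :
    MonotoneOn (fun r => cosh r * (∫ t in (0 : ℝ)..r, sinh t ^ m) / sinh r ^ (m + 1)) (Ioi 0) := by
  have hs {r : ℝ} (hr : r ∈ Ioi (0 : ℝ)) : 0 < sinh r := sinh_pos_iff.2 hr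
  have hd (r : ℝ) (hr : r ∈ Ioi (0 : ℝ)) :=
    ((hasDerivAt_cosh r).fun_mul (hasDerivAt_integral_sinh_pow m r)).fun_div
      (hasDerivAt_sinh_pow_succ m r) (pow_pos (hs hr) _).ne'
  refine monotoneOn_of_hasDerivWithinAt_nonneg (convex_Ioi 0)
    (fun r hr => (hd r hr).continuousAt.continuousWithinAt)
    (fun r hr => (hd r (interior_subset hr)).hasDerivWithinAt) fun r hr => ?_
  have hr : r ∈ Ioi (0 : ℝ) := interior_subset hr
  have hsr := hs hr
  have hle := integral_sinh_pow_le m (le_of_lt hr)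
  rw [le_div_iff₀ (by positivity)] at hle
  refine div_nonneg ?_ (by positivity)
  have hprod := mul_nonneg (pow_pos hsr m).le (sub_nonneg.2 hle)
  convert hprod using 1
  have hC : sinh r ^ 2 = cosh r ^ 2 - 1 := sinh_sq r
  linear_combination (sinh r ^ m * ∫ t in (0 : ℝ)..r, sinh t ^ m) * hC

theorem mul_cosh_mul_integral_sinh_pow_div_le_one (m : ℕ) {r : ℝ} (hr : 0 < r) :
    m * (cosh r * (∫ t in (0 : ℝ)..r, sinh t ^ m) / sinh r ^ (m + 1)) ≤ 1 := by
  have hs : 0 < sinh r := sinh_pos_iff.2 hr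
  have hc : 0 < cosh r := cosh_pos r
  have hle := integral_sinh_pow_le m hr.le
  rw [← mul_div_assoc, div_le_one (by positivity)]
  calc (m : ℝ) * (cosh r * ∫ t in (0 : ℝ)..r, sinh t ^ m)
      ≤ m * (cosh r * (cosh r * sinh r ^ (m + 1) / (m * cosh r ^ 2 + 1))) := by gcongr
    _ = m * cosh r ^ 2 * sinh r ^ (m + 1) / (m * cosh r ^ 2 + 1) := by ring
    _ ≤ sinh r ^ (m + 1) := by
      rw [div_le_iff₀ (by positivity)]
      nlinarith [pow_pos hs (m + 1)]

theorem hasDerivAt_integral_sinh_pow_div (m : ℕ) {r : ℝ} (hr : 0 < r) :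
    HasDerivAt (fun r : ℝ => (∫ t in (0 : ℝ)..r, sinh t ^ m) / sinh r ^ m)
      (1 - m * (cosh r * (∫ t in (0 : ℝ)..r, sinh t ^ m) / sinh r ^ (m + 1))) r := by
  have hs : 0 < sinh r := sinh_pos_iff.2 hr
  refine ((hasDerivAt_integral_sinh_pow m r).fun_div ((hasDerivAt_sinh r).fun_pow m)
    (pow_pos hs m).ne').congr_deriv ?_
  rcases m with _ | m
  · simp
  · simp only [Nat.add_sub_cancel]
    field_simp
    ring


/-- Let `n ≥ 2` and `g(r) = sinh(r)^{-(n-1)}·∫₀^r sinh(t)^(n-1) dt`.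
Then `g'` is nonincreasing on `(0,∞)`; in particular `(g')²` is
nonincreasing on `(0,∞)`. -/
theorem deriv_radial_steklov_solution_antitoneOn (n : ℕ) (hn : 2 ≤ n) (g : ℝ → ℝ)
    (hg : ∀ r, 0 < r →
      g r = (∫ t in (0:ℝ)..r, Real.sinh t ^ (n - 1)) / Real.sinh r ^ (n - 1)) :
    AntitoneOn (deriv g) (Set.Ioi 0) ∧
      AntitoneOn (fun r => (deriv g r) ^ 2) (Set.Ioi 0) := by
  have hderiv : ∀ r ∈ Ioi (0 : ℝ), deriv g r = 1 - (n - 1 : ℕ) *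
      (cosh r * (∫ t in (0 : ℝ)..r, sinh t ^ (n - 1)) / sinh r ^ (n - 1 + 1)) := fun r hr =>
    ((hasDerivAt_integral_sinh_pow_div (n - 1) hr).congr_of_eventuallyEq
      (Filter.eventually_of_mem (Ioi_mem_nhds hr) hg)).deriv
  have hanti : AntitoneOn (deriv g) (Ioi 0) := fun x hx y hy hxy => by
    rw [hderiv x hx, hderiv y hy]
    exact sub_le_sub_left (mul_le_mul_of_nonneg_left
      (monotoneOn_cosh_mul_integral_sinh_pow_div (n - 1) hx hy hxy) (Nat.cast_nonneg _)) 1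
  refine ⟨hanti, fun x hx y hy hxy => pow_le_pow_left₀ ?_ (hanti hx hy hxy) 2⟩
  rw [hderiv y hy]
  exact sub_nonneg.2 (mul_cosh_mul_integral_sinh_pow_div_le_one (n - 1) hy)
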